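/- Let K, N be positive integers, and for each k ∈ {1,…,K} let θ_k > 0 and A_k > 0 be real numbers, and let N₀ > 0, B > 0. Then the relaxed system effective capacity C(P, Φ) = Σ_{k=1}^K Σ_{n=1}^N −(φ_{k,n}/θ_k)·ln( (N₀·B·φ_{k,n}/p_{k,n})·e^{N₀·B·φ_{k,n}/p_{k,n}}·E_{A_k}(N₀·B·φ_{k,n}/p_{k,n}) ) is concave, jointly in the matrices P = (p_{k,n}) and Φ = (φ_{k,n}), on the convex set where p_{k,n} > 0 and 0 < φ_{k,n} ≤ 1 for all k, n, where E_A(x) = ∫_1^∞ e^{−x t}·t^{−A} dt. -/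

import Mathlib

open MeasureTheory

/-- The generalized exponential integral `E_A(x) = ∫_1^∞ e^{−x·t}·t^{−A} dt`. -/
noncomputable def expInt (A x : ℝ) : ℝ :=
  ∫ t in Set.Ioi (1 : ℝ), Real.exp (-x * t) * t ^ (-A)

/-- The Laplace-type average `∫₀^∞ e^{-u} (1 + γ u)^{-A} du`. -/
noncomputable def expMoment (A γ : ℝ) : ℝ :=
  ∫ u in Set.Ioi (0 : ℝ), Real.exp (-u) * (1 + γ * u) ^ (-A)

/-- Substituting `t = 1 + u / x` turns `x e^x E_A(x)` into `expMoment A x⁻¹`. -/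
theorem mul_exp_mul_expInt {A x : ℝ} (hx : 0 < x) :
    x * Real.exp x * expInt A x = expMoment A x⁻¹ := by
  have hshift : expInt A x =
      ∫ s in Set.Ioi (0 : ℝ), Real.exp (-x * (s + 1)) * (s + 1) ^ (-A) := by
    have h := (measurePreserving_add_right volume (1 : ℝ)).setIntegral_preimage_emb
      (measurableEmbedding_addRight 1) (fun t : ℝ => Real.exp (-x * t) * t ^ (-A)) (Set.Ioi 1)
    rw [Set.preimage_add_const_Ioi, sub_self] at h
    exact h.symm
  have hscale := integral_comp_mul_left_Ioi
    (fun s : ℝ => Real.exp (-x * (s + 1)) * (s + 1) ^ (-A)) 0 (inv_pos.2 hx)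
  rw [mul_zero, inv_inv, smul_eq_mul, ← hshift] at hscale
  rw [mul_comm x, mul_assoc, ← hscale, ← integral_const_mul, expMoment]
  refine integral_congr_ae (Filter.Eventually.of_forall fun u => ?_)
  have hexp : Real.exp (-u) = Real.exp x * Real.exp (-x * (x⁻¹ * u + 1)) := by
    rw [← Real.exp_add]
    congr 1
    field_simp
    ring
  simp only [hexp, add_comm (1 : ℝ), mul_assoc]

theorem integrableOn_expMoment {A γ : ℝ} (hA : 0 < A) (hγ : 0 < γ) :
    IntegrableOn (fun u : ℝ => Real.exp (-u) * (1 + γ * u) ^ (-A)) (Set.Ioi 0) := by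
  refine Integrable.mono' (integrableOn_exp_neg_Ioi 0) ?_ ?_
  · exact Measurable.aestronglyMeasurable (by fun_prop)
  · refine (ae_restrict_mem measurableSet_Ioi).mono fun u hu => ?_
    have hu : 0 < u := hu
    have hone : 1 ≤ 1 + γ * u := by nlinarith
    rw [Real.norm_of_nonneg (by positivity)]
    exact mul_le_of_le_one_right (Real.exp_pos _).le
      (Real.rpow_le_one_of_one_le_of_nonpos hone (by linarith))

theorem expMoment_pos {A γ : ℝ} (hA : 0 < A) (hγ : 0 < γ) : 0 < expMoment A γ := by
  have hpos : ∀ u ∈ Set.Ioi (0 : ℝ), 0 < Real.exp (-u) * (1 + γ * u) ^ (-A) := by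
    intro u hu
    have hu : 0 < u := hu
    positivity
  rw [expMoment, setIntegral_pos_iff_support_of_nonneg_ae
    ((ae_restrict_mem measurableSet_Ioi).mono fun u hu => (hpos u hu).le)
    (integrableOn_expMoment hA hγ)]
  have hsub : Set.Ioi (0 : ℝ) ⊆
      Function.support fun u : ℝ => Real.exp (-u) * (1 + γ * u) ^ (-A) :=
    fun u hu => (hpos u hu).ne'
  rw [Set.inter_eq_right.2 hsub]
  simp

/-- A mixture of the log-convex functions `γ ↦ (1 + γ u)^{-A}` is log-convex. -/
theorem convexOn_log_expMoment {A : ℝ} (hA : 0 < A) :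
    ConvexOn ℝ (Set.Ioi 0) fun γ => Real.log (expMoment A γ) := by
  refine ⟨convex_Ioi 0, fun x hx y hy a b ha hb hab => ?_⟩
  have hx : 0 < x := hx
  have hy : 0 < y := hy
  have hz : 0 < a * x + b * y := convex_Ioi (0 : ℝ) hx hy ha hb hab
  have hX := expMoment_pos hA hx
  have hY := expMoment_pos hA hy
  have hZ := expMoment_pos hA hz
  simp only [smul_eq_mul]
  set X := expMoment A x
  set Y := expMoment A y
  have hpoint : ∀ u ∈ Set.Ioi (0 : ℝ),
      Real.exp (-u) * (1 + (a * x + b * y) * u) ^ (-A) ≤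
        X ^ a * Y ^ b * (a / X * (Real.exp (-u) * (1 + x * u) ^ (-A)) +
          b / Y * (Real.exp (-u) * (1 + y * u) ^ (-A))) := by
    intro u hu
    have hu : 0 < u := hu
    have hxu : 0 < 1 + x * u := by positivity
    have hyu : 0 < 1 + y * u := by positivity
    have hgm : (1 + x * u) ^ a * (1 + y * u) ^ b ≤ 1 + (a * x + b * y) * u := by
      refine (Real.geom_mean_le_arith_mean2_weighted ha hb hxu.le hyu.le hab).trans_eq ?_
      linear_combination hab
    have hpow : (1 + (a * x + b * y) * u) ^ (-A) ≤
        ((1 + x * u) ^ (-A)) ^ a * ((1 + y * u) ^ (-A)) ^ b := by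
      refine (Real.rpow_le_rpow_of_nonpos (by positivity) hgm (by linarith)).trans_eq ?_
      rw [Real.mul_rpow (by positivity) (by positivity), ← Real.rpow_mul hxu.le,
        ← Real.rpow_mul hyu.le, ← Real.rpow_mul hxu.le, ← Real.rpow_mul hyu.le,
        mul_comm a, mul_comm b]
    have hratio := Real.geom_mean_le_arith_mean2_weighted ha hb
      (p₁ := (1 + x * u) ^ (-A) / X) (p₂ := (1 + y * u) ^ (-A) / Y)
      (by positivity) (by positivity) hab
    rw [Real.div_rpow (by positivity) hX.le, Real.div_rpow (by positivity) hY.le,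
      div_mul_div_comm, div_le_iff₀ (by positivity)] at hratio
    calc
      _ ≤ Real.exp (-u) * ((a * ((1 + x * u) ^ (-A) / X) + b * ((1 + y * u) ^ (-A) / Y)) *
            (X ^ a * Y ^ b)) :=
        mul_le_mul_of_nonneg_left (hpow.trans hratio) (Real.exp_pos _).le
      _ = _ := by ring
  have hintx := (integrableOn_expMoment hA hx).const_mul (a / X)
  have hinty := (integrableOn_expMoment hA hy).const_mul (b / Y)
  have hle : expMoment A (a * x + b * y) ≤ X ^ a * Y ^ b := by
    refine (setIntegral_mono_on (integrableOn_expMoment hA hz)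
      ((hintx.add hinty).const_mul (X ^ a * Y ^ b)) measurableSet_Ioi hpoint).trans_eq ?_
    simp only [Pi.add_apply]
    rw [integral_const_mul, integral_add hintx hinty, integral_const_mul, integral_const_mul]
    change X ^ a * Y ^ b * (a / X * X + b / Y * Y) = X ^ a * Y ^ b
    rw [div_mul_cancel₀ _ hX.ne', div_mul_cancel₀ _ hY.ne', hab, mul_one]
  refine (Real.log_le_log hZ hle).trans_eq ?_
  rw [Real.log_mul (by positivity) (by positivity), Real.log_rpow hX, Real.log_rpow hY]

/-- The perspective of a convex function on the positive half-line is jointly convex. -/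
theorem ConvexOn.perspective_le {f : ℝ → ℝ} (hf : ConvexOn ℝ (Set.Ioi 0) f)
    {p₁ p₂ s₁ s₂ a b : ℝ} (hp₁ : 0 < p₁) (hp₂ : 0 < p₂) (hs₁ : 0 < s₁) (hs₂ : 0 < s₂)
    (ha : 0 ≤ a) (hb : 0 ≤ b) (hab : a + b = 1) :
    (a * s₁ + b * s₂) * f ((a * p₁ + b * p₂) / (a * s₁ + b * s₂)) ≤
      a * (s₁ * f (p₁ / s₁)) + b * (s₂ * f (p₂ / s₂)) := by
  have hs : 0 < a * s₁ + b * s₂ := convex_Ioi (0 : ℝ) hs₁ hs₂ ha hb hab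
  have h := hf.2 (div_pos hp₁ hs₁) (div_pos hp₂ hs₂)
    (div_nonneg (mul_nonneg ha hs₁.le) hs.le) (div_nonneg (mul_nonneg hb hs₂.le) hs.le)
    (by rw [← add_div, div_self hs.ne'])
  have harg : a * s₁ / (a * s₁ + b * s₂) * (p₁ / s₁) +
      b * s₂ / (a * s₁ + b * s₂) * (p₂ / s₂) = (a * p₁ + b * p₂) / (a * s₁ + b * s₂) := by
    field_simp
  simp only [smul_eq_mul, harg] at h
  refine (mul_le_mul_of_nonneg_left h hs.le).trans_eq ?_
  field_simp

/-- For a downlink OFDMA system with `K` users, `N` subcarriers, per-user QoS-exponents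
`θ k > 0`, parameters `A k > 0`, and `N₀, B > 0`, the time-sharing-relaxed system effective
capacity `C(P, Φ) = Σ_k Σ_n −(φ_{k,n}/θ_k)·ln((N₀Bφ_{k,n}/p_{k,n})·e^{N₀Bφ_{k,n}/p_{k,n}}·
E_{A_k}(N₀Bφ_{k,n}/p_{k,n}))` is jointly concave in `(P, Φ)` on the convex set where
`p_{k,n} > 0` and `0 < φ_{k,n} ≤ 1` for all `k, n`. -/
theorem stmt_10 (K N : ℕ) (hK : 0 < K) (hN : 0 < N)
    (θ A : Fin K → ℝ) (hθ : ∀ k, 0 < θ k) (hA : ∀ k, 0 < A k)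
    (N₀ B : ℝ) (hN₀ : 0 < N₀) (hB : 0 < B) :
    ConcaveOn ℝ
      {q : (Fin K → Fin N → ℝ) × (Fin K → Fin N → ℝ) |
        ∀ k n, 0 < q.1 k n ∧ 0 < q.2 k n ∧ q.2 k n ≤ 1}
      (fun q => ∑ k, ∑ n,
        -(q.2 k n / θ k) * Real.log ((N₀ * B * q.2 k n / q.1 k n) *
          Real.exp (N₀ * B * q.2 k n / q.1 k n) *
          expInt (A k) (N₀ * B * q.2 k n / q.1 k n))) := by
  have hconv : Convex ℝ {q : (Fin K → Fin N → ℝ) × (Fin K → Fin N → ℝ) |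
      ∀ k n, 0 < q.1 k n ∧ 0 < q.2 k n ∧ q.2 k n ≤ 1} := by
    intro q hq r hr a b ha hb hab k n
    obtain ⟨hq₁, hq₂, hq₃⟩ := hq k n
    obtain ⟨hr₁, hr₂, hr₃⟩ := hr k n
    exact ⟨convex_Ioi (0 : ℝ) hq₁ hr₁ ha hb hab, convex_Ioi (0 : ℝ) hq₂ hr₂ ha hb hab,
      convex_Iic (1 : ℝ) hq₃ hr₃ ha hb hab⟩
  refine ⟨hconv, fun q hq r hr a b ha hb hab => ?_⟩
  simp only [smul_eq_mul, Finset.mul_sum, ← Finset.sum_add_distrib]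
  refine Finset.sum_le_sum fun k _ => Finset.sum_le_sum fun n _ => ?_
  have hc : 0 < N₀ * B := mul_pos hN₀ hB
  have hterm : ∀ p s : ℝ, 0 < p → 0 < s →
      -(s / θ k) * Real.log ((N₀ * B * s / p) * Real.exp (N₀ * B * s / p) *
        expInt (A k) (N₀ * B * s / p)) =
      -(1 / (θ k * (N₀ * B))) *
        ((N₀ * B * s) * Real.log (expMoment (A k) (p / (N₀ * B * s)))) := by
    intro p s hp hs
    have hθk := hθ k
    rw [mul_exp_mul_expInt (by positivity), inv_div]
    field_simp
  obtain ⟨hq₁, hq₂, -⟩ := hq k n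
  obtain ⟨hr₁, hr₂, -⟩ := hr k n
  obtain ⟨hz₁, hz₂, -⟩ := hconv hq hr ha hb hab k n
  rw [hterm _ _ hq₁ hq₂, hterm _ _ hr₁ hr₂, hterm _ _ hz₁ hz₂]
  have h := (convexOn_log_expMoment (hA k)).perspective_le hq₁ hr₁
    (mul_pos hc hq₂) (mul_pos hc hr₂) ha hb hab
  have hs : N₀ * B * (a • q + b • r).2 k n =
      a * (N₀ * B * q.2 k n) + b * (N₀ * B * r.2 k n) := by
    simp only [Prod.snd_add, Prod.smul_snd, Pi.add_apply, Pi.smul_apply, smul_eq_mul]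
    ring
  have hp : (a • q + b • r).1 k n = a * q.1 k n + b * r.1 k n := rfl
  have hpos : 0 ≤ 1 / (θ k * (N₀ * B)) := by
    have hθk := hθ k
    positivity
  rw [hs, hp]
  linarith [mul_le_mul_of_nonneg_left h hpos]
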